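/- arXiv:1708.00285 — 2 statements merged into one kernel-verified Lean document; each statement's English description precedes it below -/
import Mathlib

section
/- Let 1 < p < ∞, 0 < q < ∞, and α < n/p'. Suppose b ∈ CBMO^{max(p,p')}(ℝⁿ). Then the commutator [b,H] of the n-dimensional Hardy operator is bounded on the homogeneous Herz space K̇^{α,q}_p(ℝⁿ): ‖[b,H]f‖_{K̇^{α,q}_p} ≤ C ‖f‖_{K̇^{α,q}_p}. -/
open MeasureTheory Metric ENNReal

abbrev En (n : ℕ) := EuclideanSpace ℝ (Fin n)

/-- The `n`-dimensional Hardy operator `Hf(x) = |x|^{-n} ∫_{|y| ≤ |x|} f(y) dy`. -/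
noncomputable def hardyOp (n : ℕ) (f : En n → ℝ) : En n → ℝ := fun x =>
  ‖x‖ ^ (-(n : ℝ)) * ∫ y in closedBall (0 : En n) ‖x‖, f y

/-- The annulus `C_k = B(0,2^k) \ B(0,2^{k-1})`. -/
noncomputable def annulus (n : ℕ) (k : ℤ) : Set (En n) :=
  ball (0 : En n) ((2 : ℝ) ^ k) \ ball (0 : En n) ((2 : ℝ) ^ (k - 1))

/-- The homogeneous Herz norm `‖f‖_{K̇^{α,q}_p} = (Σ_k 2^{αqk} ‖f χ_{C_k}‖_{L^p}^q)^{1/q}`. -/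
noncomputable def herzNorm (n : ℕ) (α p q : ℝ) (f : En n → ℝ) : ℝ≥0∞ :=
  (∑' k : ℤ, (ENNReal.ofReal ((2 : ℝ) ^ (α * (k : ℝ))) *
      eLpNorm f (ENNReal.ofReal p) (volume.restrict (annulus n k))) ^ q) ^ (1 / q)


lemma rpow_sum_le_aux {ι : Type*} (s : Finset ι) (a : ι → ℝ≥0∞) {q : ℝ} (h0 : 0 < q) (h1 : q ≤ 1) :
    (∑ i ∈ s, a i) ^ q ≤ ∑ i ∈ s, a i ^ q := by
  classical
  induction s using Finset.induction_on with
  | empty => simp [h0]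
  | insert i s hi ih =>
    rw [Finset.sum_insert hi, Finset.sum_insert hi]
    exact (ENNReal.rpow_add_le_add_rpow _ _ h0.le h1).trans (by gcongr)

lemma tsum_rpow_le_of_finset {ι : Type*} (a : ι → ℝ≥0∞) {q : ℝ} (h0 : 0 < q) {B : ℝ≥0∞}
    (h : ∀ s : Finset ι, (∑ i ∈ s, a i) ^ q ≤ B) : (∑' i, a i) ^ q ≤ B := by
  rw [← ENNReal.le_rpow_inv_iff h0, ENNReal.tsum_eq_iSup_sum]
  refine iSup_le fun s => ?_
  rw [ENNReal.le_rpow_inv_iff h0]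
  exact h s

lemma conv_tsum_swap (w : ℕ → ℝ≥0∞) (A : ℤ → ℝ≥0∞) :
    ∑' k : ℤ, ∑' m : ℕ, w m * A (k - m) = (∑' m, w m) * ∑' k, A k := by
  rw [ENNReal.tsum_comm, ← ENNReal.tsum_mul_right]
  congr 1; ext m
  rw [ENNReal.tsum_mul_left]
  congr 1
  exact (Equiv.subRight (m : ℤ)).tsum_eq A

lemma conv_bound (r : ℝ≥0∞) (hr : r < 1) (q : ℝ) (hq : 0 < q) :
    ∃ K : ℝ≥0∞, K ≠ ∞ ∧ ∀ A : ℤ → ℝ≥0∞,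
      ∑' k : ℤ, (∑' m : ℕ, r ^ m * A (k - m)) ^ q ≤ K * ∑' k, A k ^ q := by
  have geo : ∀ t : ℝ≥0∞, t < 1 → ∑' m : ℕ, t ^ m ≠ ∞ := by
    intro t ht
    rw [ENNReal.tsum_geometric, ENNReal.inv_ne_top]
    exact (tsub_pos_of_lt ht).ne'
  rcases le_total q 1 with h1 | h1
  · refine ⟨∑' m : ℕ, (r ^ q) ^ m, geo _ (ENNReal.rpow_lt_one hr hq), fun A => ?_⟩
    rw [← conv_tsum_swap]
    refine ENNReal.tsum_le_tsum fun k => ?_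
    refine tsum_rpow_le_of_finset _ hq fun s => (rpow_sum_le_aux s _ hq h1).trans ?_
    refine le_trans (le_of_eq ?_) (ENNReal.sum_le_tsum s)
    refine Finset.sum_congr rfl fun m _ => ?_
    rw [ENNReal.mul_rpow_of_nonneg _ _ hq.le, ← ENNReal.rpow_natCast, ← ENNReal.rpow_natCast,
      ← ENNReal.rpow_mul, ← ENNReal.rpow_mul, mul_comm q]
  · refine ⟨(∑' m : ℕ, r ^ m) ^ (q - 1) * ∑' m : ℕ, r ^ m, ?_, fun A => ?_⟩
    · exact ENNReal.mul_ne_top (ENNReal.rpow_ne_top_of_nonneg (by linarith) (geo r hr)) (geo r hr)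
    rw [mul_assoc, ← conv_tsum_swap, ← ENNReal.tsum_mul_left]
    refine ENNReal.tsum_le_tsum fun k => ?_
    refine tsum_rpow_le_of_finset _ hq fun s => ?_
    have h := ENNReal.inner_le_weight_mul_Lp_of_nonneg s h1 (fun m => r ^ m) (fun m => A (k - m))
    refine (ENNReal.rpow_le_rpow h hq.le).trans ?_
    rw [ENNReal.mul_rpow_of_nonneg _ _ hq.le, ← ENNReal.rpow_mul, ← ENNReal.rpow_mul,
      inv_mul_cancel₀ hq.ne', ENNReal.rpow_one, sub_mul, inv_mul_cancel₀ hq.ne', one_mul]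
    gcongr
    · exact ENNReal.sum_le_tsum s
    · exact ENNReal.sum_le_tsum s

lemma vol_ball (n : ℕ) (k : ℤ) : volume (ball (0 : En n) ((2:ℝ)^k)) =
    ENNReal.ofReal ((2:ℝ) ^ ((n:ℝ) * k)) * volume (ball (0 : En n) 1) := by
  rw [Measure.addHaar_ball_of_pos _ _ (by positivity)]
  congr 2
  rw [finrank_euclideanSpace_fin, mul_comm, Real.rpow_mul (by norm_num), Real.rpow_intCast, Real.rpow_natCast]

lemma ball_sub_annuli (n : ℕ) (k : ℤ) : ball (0 : En n) ((2:ℝ)^k) ⊆ {0} ∪ ⋃ m : ℕ, annulus n (k - m) := by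
  intro x hx
  by_cases h : x = 0
  · simp [h]
  right
  obtain ⟨j, hj1, hj2⟩ := exists_mem_Ico_zpow (norm_pos_iff.2 h) (_root_.one_lt_two (α := ℝ))
  have hx' : ‖x‖ < (2:ℝ)^k := by simpa using hx
  have : j < k := by
    have := hj1.trans_lt hx'
    exact (zpow_lt_zpow_iff_right₀ _root_.one_lt_two).1 this
  rw [Set.mem_iUnion]
  refine ⟨(k - (j+1)).toNat, ?_⟩
  have e : k - ((k - (j+1)).toNat : ℤ) = j + 1 := by omega
  rw [e]
  simp only [annulus, Set.mem_sdiff, mem_ball, dist_zero_right, not_lt]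
  exact ⟨hj2, by simpa using hj1⟩

lemma lintegral_ball_le (n : ℕ) (hn : 0 < n) (k : ℤ) (g : En n → ℝ≥0∞) :
    ∫⁻ y in ball (0 : En n) ((2:ℝ)^k), g y ≤ ∑' m : ℕ, ∫⁻ y in annulus n (k - m), g y := by
  have : Nonempty (Fin n) := ⟨⟨0, hn⟩⟩
  refine (lintegral_mono_set (ball_sub_annuli n k)).trans ((lintegral_union_le _ _ _).trans ?_)
  rw [Measure.restrict_singleton]
  simp only [measure_singleton, zero_smul, lintegral_zero_measure, zero_add]
  exact lintegral_iUnion_le _ _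

lemma meas_annulus (n : ℕ) (k : ℤ) : MeasurableSet (annulus n k) :=
  measurableSet_ball.diff measurableSet_ball

/-- From the integral hypothesis to the `eLpNorm` bound. -/
lemma cbmo_bound {n : ℕ} {s M R c : ℝ} (hs : 1 ≤ s) (hM : 0 ≤ M) {b : En n → ℝ}
    (hb : IntegrableOn b (ball (0 : En n) R) volume)
    (hi : IntegrableOn (fun x => |b x - c| ^ s) (ball (0 : En n) R) volume)
    (h : ∫ x in ball (0 : En n) R, |b x - c| ^ s ≤ M ^ s * (volume (ball (0 : En n) R)).toReal)
    (r : ℝ) (hr : 1 ≤ r) (hrs : r ≤ s) :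
    eLpNorm (fun x => b x - c) (ENNReal.ofReal r) (volume.restrict (ball (0 : En n) R)) ≤
      ENNReal.ofReal M * volume (ball (0 : En n) R) ^ (1 / r) := by
  have hs0 : 0 < s := by linarith
  have hr0 : 0 < r := by linarith
  set μ := (volume.restrict (ball (0 : En n) R)) with hμ
  have hV : volume (ball (0 : En n) R) ≠ ∞ := measure_ball_lt_top.ne
  have h1 : eLpNorm (fun x => b x - c) (ENNReal.ofReal s) μ ≤
      ENNReal.ofReal M * volume (ball (0 : En n) R) ^ (1 / s) := by
    rw [eLpNorm_eq_lintegral_rpow_enorm_toReal (by simpa using hs0) (by simp),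
      ENNReal.toReal_ofReal hs0.le]
    have e : ∫⁻ x, ‖b x - c‖ₑ ^ s ∂μ = ENNReal.ofReal (∫ x, |b x - c| ^ s ∂μ) := by
      rw [ofReal_integral_eq_lintegral_ofReal hi (Filter.Eventually.of_forall fun x => by positivity)]
      refine lintegral_congr fun x => ?_
      rw [Real.enorm_eq_ofReal_abs, ENNReal.ofReal_rpow_of_nonneg (abs_nonneg _) hs0.le]
    rw [e]
    calc _ ≤ (ENNReal.ofReal (M ^ s * (volume (ball (0 : En n) R)).toReal)) ^ (1/s) := by gcongr
      _ = _ := by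
        rw [ENNReal.ofReal_mul (by positivity), ENNReal.ofReal_toReal hV,
          ENNReal.mul_rpow_of_nonneg _ _ (by positivity),
          ← ENNReal.ofReal_rpow_of_nonneg hM hs0.le, ← ENNReal.rpow_mul, mul_one_div_cancel hs0.ne',
          ENNReal.rpow_one]
  have hm : AEStronglyMeasurable (fun x => b x - c) μ :=
    hb.aestronglyMeasurable.sub aestronglyMeasurable_const
  refine (eLpNorm_le_eLpNorm_mul_rpow_measure_univ (ENNReal.ofReal_le_ofReal hrs) hm).trans ?_
  rw [ENNReal.toReal_ofReal hs0.le, ENNReal.toReal_ofReal hr0.le, hμ, Measure.restrict_apply_univ]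
  refine (mul_le_mul_left h1 _).trans (le_of_eq ?_)
  rw [mul_assoc, ← ENNReal.rpow_add_of_nonneg _ _ (by positivity)]
  · congr 2; ring
  · rw [sub_nonneg]; exact one_div_le_one_div_of_le hr0 hrs

/-- Average of `b` over the dyadic ball of radius `2 ^ k`. -/
noncomputable def dyAvg {n : ℕ} (b : En n → ℝ) (k : ℤ) : ℝ := ⨍ y in ball (0 : En n) ((2:ℝ)^k), b y

lemma avg_step {n : ℕ} {M : ℝ} (hM : 0 ≤ M) {b : En n → ℝ}
    (hb : ∀ r : ℝ, 0 < r → IntegrableOn b (ball (0 : En n) r) volume)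
    (h1 : ∀ k : ℤ, eLpNorm (fun x => b x - dyAvg b k) 1
      (volume.restrict (ball (0 : En n) ((2:ℝ)^k))) ≤
        ENNReal.ofReal M * volume (ball (0 : En n) ((2:ℝ)^k))) (j : ℤ) :
    |dyAvg b j - dyAvg b (j+1)| ≤ 2 ^ n * M := by
  set c := dyAvg b (j+1) with hc
  have hbj := hb ((2:ℝ)^j) (by positivity)
  have hVpos : 0 < volume (ball (0 : En n) ((2:ℝ)^j)) := measure_ball_pos _ _ (by positivity)
  have hVfin : volume (ball (0 : En n) ((2:ℝ)^j)) ≠ ∞ := measure_ball_lt_top.ne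
  set V := volume (ball (0 : En n) ((2:ℝ)^j)) with hV
  have hVr : 0 < V.toReal := ENNReal.toReal_pos hVpos.ne' hVfin
  have hfin : IsFiniteMeasure (volume.restrict (ball (0 : En n) ((2:ℝ)^j))) :=
    ⟨by simpa using hVfin.lt_top⟩
  have e1 : ∫ y in ball (0 : En n) ((2:ℝ)^j), (b y - c) = V.toReal * (dyAvg b j - c) := by
    rw [integral_sub hbj (integrable_const _), dyAvg, setAverage_eq]
    simp only [integral_const, smul_eq_mul, Measure.real, Measure.restrict_apply_univ, ← hV]
    field_simp
  have hV1 : volume (ball (0 : En n) ((2:ℝ)^(j+1))) = ENNReal.ofReal (2^n) * V := by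
    rw [hV, vol_ball, vol_ball, ← mul_assoc, ← ENNReal.ofReal_mul (by positivity)]
    congr 2
    rw [← Real.rpow_natCast, ← Real.rpow_add (by norm_num)]
    congr 1; push_cast; ring
  have e2 : ‖∫ y in ball (0 : En n) ((2:ℝ)^j), (b y - c)‖ₑ ≤ ENNReal.ofReal (2^n * M * V.toReal) := by
    refine (enorm_integral_le_lintegral_enorm _).trans ?_
    have hsub : ball (0 : En n) ((2:ℝ)^j) ⊆ ball (0 : En n) ((2:ℝ)^(j+1)) :=
      ball_subset_ball (zpow_le_zpow_right₀ (by norm_num) (by omega))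
    refine (lintegral_mono_set hsub).trans ?_
    rw [← eLpNorm_one_eq_lintegral_enorm]
    refine (h1 (j+1)).trans (le_of_eq ?_)
    rw [hV1, ENNReal.ofReal_mul (by positivity), ENNReal.ofReal_mul (by positivity),
      ENNReal.ofReal_toReal hVfin]
    ring
  rw [e1, Real.enorm_eq_ofReal_abs, ENNReal.ofReal_le_ofReal_iff (by positivity), abs_mul,
    abs_of_pos hVr, mul_comm] at e2
  exact le_of_mul_le_mul_right e2 hVr

lemma avg_diff {n : ℕ} {M : ℝ} {b : En n → ℝ}
    (h : ∀ j, |dyAvg b j - dyAvg b (j+1)| ≤ 2 ^ n * M) (k : ℤ) (m : ℕ) :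
    |dyAvg b (k - m) - dyAvg b k| ≤ m * (2 ^ n * M) := by
  induction m with
  | zero => simp
  | succ m ih =>
    have := h (k - (m+1 : ℕ))
    have e : k - ((m+1 : ℕ):ℤ) + 1 = k - m := by push_cast; ring
    rw [e] at this
    calc _ ≤ _ := abs_sub_le _ (dyAvg b (k - m)) _
      _ ≤ _ := add_le_add this ih
      _ = _ := by push_cast; ring

lemma osc_small {n : ℕ} {M r : ℝ} (hM : 0 ≤ M) (hr : 1 ≤ r) {b : En n → ℝ}
    (hb : ∀ r : ℝ, 0 < r → IntegrableOn b (ball (0 : En n) r) volume)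
    (h : ∀ j, |dyAvg b j - dyAvg b (j+1)| ≤ 2 ^ n * M)
    (h1 : ∀ k : ℤ, eLpNorm (fun x => b x - dyAvg b k) (ENNReal.ofReal r)
      (volume.restrict (ball (0 : En n) ((2:ℝ)^k))) ≤
        ENNReal.ofReal M * volume (ball (0 : En n) ((2:ℝ)^k)) ^ (1/r)) (k : ℤ) (m : ℕ) :
    eLpNorm (fun x => b x - dyAvg b k) (ENNReal.ofReal r)
      (volume.restrict (ball (0 : En n) ((2:ℝ)^(k-m)))) ≤
        ENNReal.ofReal ((1 + m * 2^n) * M) * volume (ball (0 : En n) ((2:ℝ)^(k-m))) ^ (1/r) := by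
  have hr0 : 0 < r := by linarith
  have e : (fun x => b x - dyAvg b k) = (fun x => b x - dyAvg b (k-m)) +
      (fun _ => dyAvg b (k-m) - dyAvg b k) := by ext x; simp
  have hbj := (hb ((2:ℝ)^(k-m)) (by positivity)).aestronglyMeasurable
  rw [e]
  refine (eLpNorm_add_le (hbj.sub aestronglyMeasurable_const) aestronglyMeasurable_const
    (by simpa using hr)).trans ?_
  rw [eLpNorm_const' _ (by simpa using hr0) (by simp), ENNReal.toReal_ofReal hr0.le,
    Measure.restrict_apply_univ]
  have h2 : ‖dyAvg b (k-m) - dyAvg b k‖ₑ ≤ ENNReal.ofReal (m * (2 ^ n * M)) := by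
    rw [Real.enorm_eq_ofReal_abs]
    exact ENNReal.ofReal_le_ofReal (avg_diff h k m)
  refine (add_le_add (h1 (k-m)) (mul_le_mul_left h2 _)).trans (le_of_eq ?_)
  rw [← add_mul, ← ENNReal.ofReal_add hM (by positivity)]
  congr 2; ring

lemma holder_annulus {n : ℕ} {p p' : ℝ} (hpp : p.HolderConjugate p') {f g : En n → ℝ}
    (k : ℤ) (hf : AEStronglyMeasurable f (volume.restrict (annulus n k)))
    (hg : AEStronglyMeasurable g (volume.restrict (annulus n k))) :
    ∫⁻ y in annulus n k, ‖g y * f y‖ₑ ≤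
      eLpNorm f (ENNReal.ofReal p) (volume.restrict (annulus n k)) *
      eLpNorm g (ENNReal.ofReal p') (volume.restrict (ball (0 : En n) ((2:ℝ)^k))) := by
  have h := ENNReal.lintegral_mul_le_Lp_mul_Lq (volume.restrict (annulus n k)) hpp hf.enorm hg.enorm
  have hsub : annulus n k ⊆ ball (0 : En n) ((2:ℝ)^k) := Set.sdiff_subset
  refine le_trans ?_ (mul_le_mul_right (eLpNorm_mono_measure g (Measure.restrict_mono_set volume hsub)) _)
  rw [eLpNorm_eq_lintegral_rpow_enorm_toReal (by simpa using hpp.pos) (by simp),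
    eLpNorm_eq_lintegral_rpow_enorm_toReal (by simpa using hpp.symm.pos) (by simp),
    ENNReal.toReal_ofReal hpp.nonneg, ENNReal.toReal_ofReal hpp.symm.nonneg]
  refine le_trans (le_of_eq ?_) h
  refine lintegral_congr fun y => ?_
  simp [enorm_mul, mul_comm]

/-- Pointwise bound for the commutator. -/
lemma pointwise_bound {n : ℕ} {b f : En n → ℝ} {k : ℤ} {c : ℝ}
    (hf : IntegrableOn f (ball (0 : En n) ((2:ℝ)^k)) volume)
    (hbf : IntegrableOn (fun y => (b y - c) * f y) (ball (0 : En n) ((2:ℝ)^k)) volume)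
    {x : En n} (hx : x ∈ annulus n k) :
    |b x * hardyOp n f x - hardyOp n (fun y => b y * f y) x| ≤
      (2:ℝ) ^ ((n:ℝ) * (1 - k)) * (|b x - c| * (∫ y in ball (0 : En n) ((2:ℝ)^k), |f y|) +
        ∫ y in ball (0 : En n) ((2:ℝ)^k), |(b y - c) * f y|) := by
  have hx1 : ‖x‖ < (2:ℝ)^k := by simpa using hx.1
  have hx2 : (2:ℝ)^(k-1) ≤ ‖x‖ := by simpa using hx.2
  have hsub : closedBall (0 : En n) ‖x‖ ⊆ ball (0 : En n) ((2:ℝ)^k) := closedBall_subset_ball hx1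
  have hf' := hf.mono_set hsub
  have hbf' := hbf.mono_set hsub
  have e : ∫ y in closedBall (0 : En n) ‖x‖, b y * f y =
      (∫ y in closedBall (0 : En n) ‖x‖, (b y - c) * f y) + c * ∫ y in closedBall (0 : En n) ‖x‖, f y := by
    rw [← integral_const_mul, ← integral_add hbf' (hf'.const_mul c)]
    congr 1; ext y; ring
  have e2 : b x * hardyOp n f x - hardyOp n (fun y => b y * f y) x = ‖x‖ ^ (-(n:ℝ)) *
      ((b x - c) * (∫ y in closedBall (0 : En n) ‖x‖, f y) -
        ∫ y in closedBall (0 : En n) ‖x‖, (b y - c) * f y) := by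
    simp only [hardyOp, e]; ring
  have bd : ∀ g : En n → ℝ, IntegrableOn g (ball (0 : En n) ((2:ℝ)^k)) volume →
      |∫ y in closedBall (0 : En n) ‖x‖, g y| ≤ ∫ y in ball (0 : En n) ((2:ℝ)^k), |g y| := by
    intro g hg
    refine (abs_integral_le_integral_abs).trans ?_
    exact setIntegral_mono_set hg.abs (Filter.Eventually.of_forall fun y => abs_nonneg _) hsub.eventuallyLE
  have hw : ‖x‖ ^ (-(n:ℝ)) ≤ (2:ℝ) ^ ((n:ℝ) * (1 - k)) := by
    calc ‖x‖ ^ (-(n:ℝ)) ≤ ((2:ℝ)^(k-1)) ^ (-(n:ℝ)) :=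
          Real.rpow_le_rpow_of_nonpos (by positivity) hx2 (by simp)
      _ = _ := by
        rw [← Real.rpow_intCast, ← Real.rpow_mul (by norm_num)]
        congr 1; push_cast; ring
  rw [e2, abs_mul, abs_of_nonneg (by positivity : 0 ≤ ‖x‖ ^ (-(n:ℝ)))]
  refine mul_le_mul hw ?_ (abs_nonneg _) (by positivity)
  refine (abs_sub _ _).trans ?_
  rw [abs_mul]
  gcongr
  · exact bd f hf
  · exact bd _ hbf

lemma annulus_bound {n : ℕ} (hn : 0 < n) {M p p' : ℝ} (hM : 0 < M) (hpp : p.HolderConjugate p')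
    {b f : En n → ℝ} (hfm : Measurable f)
    (hb : ∀ r : ℝ, 0 < r → IntegrableOn b (ball (0 : En n) r) volume) (k : ℤ)
    (hp1 : eLpNorm (fun x => b x - dyAvg b k) (ENNReal.ofReal p)
      (volume.restrict (ball (0 : En n) ((2:ℝ)^k))) ≤
        ENNReal.ofReal M * volume (ball (0 : En n) ((2:ℝ)^k)) ^ (1/p))
    (hp2 : ∀ m : ℕ, eLpNorm (fun x => b x - dyAvg b k) (ENNReal.ofReal p')
      (volume.restrict (ball (0 : En n) ((2:ℝ)^(k-m)))) ≤
        ENNReal.ofReal ((1 + m * 2^n) * M) * volume (ball (0 : En n) ((2:ℝ)^(k-m))) ^ (1/p')) :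
    eLpNorm (fun x => b x * hardyOp n f x - hardyOp n (fun y => b y * f y) x) (ENNReal.ofReal p)
      (volume.restrict (annulus n k)) ≤
    ENNReal.ofReal ((2:ℝ) ^ ((n:ℝ) * (1 - k))) *
      (ENNReal.ofReal M * volume (ball (0 : En n) ((2:ℝ)^k)) ^ (1/p)) *
      ∑' m : ℕ, ENNReal.ofReal (2 + m * 2^n) *
        (eLpNorm f (ENNReal.ofReal p) (volume.restrict (annulus n (k-m))) *
          volume (ball (0 : En n) ((2:ℝ)^(k-m))) ^ (1/p')) := by
  set F : ℕ → ℝ≥0∞ := fun m => eLpNorm f (ENNReal.ofReal p) (volume.restrict (annulus n (k-m))) *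
          volume (ball (0 : En n) ((2:ℝ)^(k-m))) ^ (1/p') with hF
  set S1 := ∑' m : ℕ, F m with hS1
  set S2 := ∑' m : ℕ, ENNReal.ofReal (1 + m * 2^n) * F m with hS2
  have hS : ∑' m : ℕ, ENNReal.ofReal (2 + m * 2^n) * F m = S1 + S2 := by
    rw [hS1, hS2, ← ENNReal.tsum_add]
    congr 1; ext m
    rw [show (2:ℝ) + m * 2^n = 1 + (1 + m * 2^n) by ring,
      ENNReal.ofReal_add zero_le_one (by positivity), ENNReal.ofReal_one]
    ring
  change _ ≤ _ * ∑' m : ℕ, ENNReal.ofReal (2 + m * 2^n) * F m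
  rw [hS]
  set V := volume (ball (0 : En n) ((2:ℝ)^k)) with hV
  have hVpos : 0 < V := measure_ball_pos _ _ (by positivity)
  have hVfin : V ≠ ∞ := measure_ball_lt_top.ne
  have hw : (0:ℝ) < (2:ℝ) ^ ((n:ℝ) * (1 - k)) := by positivity
  set w := (2:ℝ) ^ ((n:ℝ) * (1 - k)) with hwdef
  by_cases htop : S1 + S2 = ∞
  · rw [htop, ENNReal.mul_top]
    · exact le_top
    · refine mul_ne_zero (by simpa using hw) (mul_ne_zero (by simpa using hM) ?_)
      exact (ENNReal.rpow_pos hVpos hVfin).ne'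
  rw [ENNReal.add_eq_top, not_or] at htop
  obtain ⟨ht1, ht2⟩ := htop
  set c := dyAvg b k with hc
  have hbm : ∀ k : ℤ, AEStronglyMeasurable (fun x => b x - c)
      (volume.restrict (ball (0 : En n) ((2:ℝ)^k))) := fun k =>
    (hb ((2:ℝ)^k) (by positivity)).aestronglyMeasurable.sub aestronglyMeasurable_const
  have hsub : ∀ k : ℤ, annulus n k ⊆ ball (0 : En n) ((2:ℝ)^k) := fun k => Set.sdiff_subset
  have hI1 : ∫⁻ y in ball (0 : En n) ((2:ℝ)^k), ‖f y‖ₑ ≤ S1 := by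
    refine (lintegral_ball_le n hn k _).trans (ENNReal.tsum_le_tsum fun m => ?_)
    have := holder_annulus hpp (f := f) (g := fun _ => 1) (k - m) hfm.aestronglyMeasurable
      aestronglyMeasurable_const
    rw [eLpNorm_const' _ (by simpa using hpp.symm.pos) (by simp),
      ENNReal.toReal_ofReal hpp.symm.nonneg, Measure.restrict_apply_univ] at this
    simpa [hF] using this
  have hI2 : ∫⁻ y in ball (0 : En n) ((2:ℝ)^k), ‖(b y - c) * f y‖ₑ ≤ ENNReal.ofReal M * S2 := by
    rw [hS2, ← ENNReal.tsum_mul_left]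
    refine (lintegral_ball_le n hn k _).trans (ENNReal.tsum_le_tsum fun m => ?_)
    refine (holder_annulus hpp (f := f) (g := fun y => b y - c) (k - m) hfm.aestronglyMeasurable
      ((hbm (k-m)).mono_set (hsub _))).trans ?_
    refine (mul_le_mul_right (hp2 m) _).trans (le_of_eq ?_)
    rw [ENNReal.ofReal_mul (by positivity), hF]
    ring
  have hfi : IntegrableOn f (ball (0 : En n) ((2:ℝ)^k)) volume :=
    ⟨hfm.aestronglyMeasurable, hI1.trans_lt (lt_top_iff_ne_top.2 ht1)⟩
  have hbfi : IntegrableOn (fun y => (b y - c) * f y) (ball (0 : En n) ((2:ℝ)^k)) volume :=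
    ⟨(hbm k).mul hfm.aestronglyMeasurable,
      hI2.trans_lt (ENNReal.mul_lt_top ENNReal.ofReal_lt_top (lt_top_iff_ne_top.2 ht2))⟩
  set J1 := ∫ y in ball (0 : En n) ((2:ℝ)^k), |f y| with hJ1
  set J2 := ∫ y in ball (0 : En n) ((2:ℝ)^k), |(b y - c) * f y| with hJ2
  have hJ1' : ‖J1‖ₑ ≤ S1 := by
    refine le_trans (le_of_eq ?_) hI1
    rw [Real.enorm_eq_ofReal (integral_nonneg fun _ => abs_nonneg _)]
    exact ofReal_integral_norm_eq_lintegral_enorm hfi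
  have hJ2' : ‖J2‖ₑ ≤ ENNReal.ofReal M * S2 := by
    refine le_trans (le_of_eq ?_) hI2
    rw [Real.enorm_eq_ofReal (integral_nonneg fun _ => abs_nonneg _)]
    exact ofReal_integral_norm_eq_lintegral_enorm hbfi
  have hmono : eLpNorm (fun x => b x * hardyOp n f x - hardyOp n (fun y => b y * f y) x)
      (ENNReal.ofReal p) (volume.restrict (annulus n k)) ≤
      eLpNorm (w • (J1 • (fun x => |b x - c|) + fun _ => J2)) (ENNReal.ofReal p)
        (volume.restrict (annulus n k)) := by
    refine eLpNorm_mono_ae_real ?_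
    refine (ae_restrict_mem (meas_annulus n k)).mono fun x hx => ?_
    have := pointwise_bound hfi hbfi hx
    simp only [Pi.smul_apply, Pi.add_apply, smul_eq_mul, Real.norm_eq_abs]
    rw [mul_comm J1]
    exact this
  refine hmono.trans ((eLpNorm_mono_measure _ (Measure.restrict_mono_set volume (hsub k))).trans ?_)
  have habs : AEStronglyMeasurable (fun x => |b x - c|)
      (volume.restrict (ball (0 : En n) ((2:ℝ)^k))) := (hbm k).norm
  rw [eLpNorm_const_smul, Real.enorm_eq_ofReal hw.le, mul_assoc]
  gcongr
  refine (eLpNorm_add_le (habs.const_smul J1) aestronglyMeasurable_const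
    (by simpa using hpp.lt.le)).trans ?_
  rw [eLpNorm_const_smul, eLpNorm_const' _ (by simpa using hpp.pos) (by simp),
    ENNReal.toReal_ofReal hpp.nonneg, Measure.restrict_apply_univ]
  have hn' : eLpNorm (fun x => |b x - c|) (ENNReal.ofReal p)
      (volume.restrict (ball (0 : En n) ((2:ℝ)^k))) ≤ ENNReal.ofReal M * V ^ (1/p) :=
    le_trans (le_of_eq (eLpNorm_norm (fun x => b x - c))) hp1
  calc _ ≤ S1 * (ENNReal.ofReal M * V ^ (1/p)) + (ENNReal.ofReal M * S2) * V ^ (1/p) := by gcongr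
    _ = _ := by ring

lemma zero_case {n : ℕ} {p : ℝ} (hp : 0 < p)
    {b f : En n → ℝ} (k : ℤ) {c : ℝ}
    (hbm : AEStronglyMeasurable (fun x => b x - c) (volume.restrict (ball (0 : En n) ((2:ℝ)^k))))
    (hp1 : eLpNorm (fun x => b x - c) (ENNReal.ofReal p)
      (volume.restrict (ball (0 : En n) ((2:ℝ)^k))) = 0) :
    eLpNorm (fun x => b x * hardyOp n f x - hardyOp n (fun y => b y * f y) x) (ENNReal.ofReal p)
      (volume.restrict (annulus n k)) = 0 := by
  rw [eLpNorm_eq_zero_iff hbm (by simpa using hp)] at hp1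
  have hsub : annulus n k ⊆ ball (0 : En n) ((2:ℝ)^k) := Set.sdiff_subset
  have h2 := ae_restrict_of_ae_restrict_of_subset hsub hp1
  refine (eLpNorm_congr_ae ?_).trans eLpNorm_zero
  filter_upwards [h2, ae_restrict_mem (meas_annulus n k)] with x hx hxk
  have hx1 : ‖x‖ < (2:ℝ)^k := by simpa using hxk.1
  have h3 := ae_restrict_of_ae_restrict_of_subset (closedBall_subset_ball (x := (0 : En n)) hx1) hp1
  have e : ∫ y in closedBall (0 : En n) ‖x‖, b y * f y =
      c * ∫ y in closedBall (0 : En n) ‖x‖, f y := by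
    rw [← integral_const_mul]
    refine integral_congr_ae ?_
    filter_upwards [h3] with y hy
    have : b y = c := by simpa [sub_eq_zero] using hy
    rw [this]
  have hxc : b x = c := by simpa [sub_eq_zero] using hx
  simp only [hardyOp, e, hxc, Pi.zero_apply]
  ring

lemma poly_exp_bound (n : ℕ) {d : ℝ} (hd : 0 < d) :
    ∃ C : ℝ, 0 < C ∧ ∀ m : ℕ, (2:ℝ) + m * 2^n ≤ C * 2 ^ ((m:ℝ) * d) := by
  have hl : 0 < Real.log 2 := Real.log_pos (by norm_num)
  refine ⟨2 + 2^n / (d * Real.log 2), by positivity, fun m => ?_⟩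
  have h1 : (1:ℝ) ≤ 2 ^ ((m:ℝ) * d) := Real.one_le_rpow (by norm_num) (by positivity)
  have h2 : (m:ℝ) * (d * Real.log 2) ≤ 2 ^ ((m:ℝ) * d) := by
    rw [Real.rpow_def_of_pos (by norm_num)]
    have := Real.add_one_le_exp (Real.log 2 * (m * d))
    linarith
  have h3 : (m:ℝ) * 2^n ≤ 2^n / (d * Real.log 2) * 2 ^ ((m:ℝ) * d) := by
    rw [div_mul_eq_mul_div, le_div_iff₀ (by positivity)]
    calc (m:ℝ) * 2^n * (d * Real.log 2) = 2^n * (m * (d * Real.log 2)) := by ring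
      _ ≤ _ := by gcongr
  linarith

lemma vol_rpow (n : ℕ) (k : ℤ) {t : ℝ} (ht : 0 ≤ t) :
    volume (ball (0 : En n) ((2:ℝ)^k)) ^ t =
      ENNReal.ofReal ((2:ℝ) ^ ((n:ℝ) * k * t) * (volume (ball (0 : En n) 1)).toReal ^ t) := by
  rw [vol_ball, ENNReal.mul_rpow_of_nonneg _ _ ht, ENNReal.ofReal_rpow_of_nonneg (by positivity) ht,
    ← Real.rpow_mul (by norm_num), ENNReal.ofReal_mul (by positivity),
    ← ENNReal.ofReal_rpow_of_nonneg ENNReal.toReal_nonneg ht,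
    ENNReal.ofReal_toReal measure_ball_lt_top.ne]

lemma coeff_bound {n : ℕ} {p p' α C v M : ℝ} (hv : 0 < v) (hM : 0 ≤ M)
    (hpp : p.HolderConjugate p') (k : ℤ) (m : ℕ) {d : ℝ} (hd : 2 * d = n * (1/p') - α)
    (hC : (2:ℝ) + m * 2^n ≤ C * 2 ^ ((m:ℝ) * d)) :
    (2:ℝ) ^ (α * k) * ((2:ℝ) ^ ((n:ℝ) * (1 - k)) * (M * ((2:ℝ) ^ ((n:ℝ) * k * (1/p)) * v ^ (1/p))) *
      ((2 + m * 2^n) * ((2:ℝ) ^ ((n:ℝ) * (k - m : ℤ) * (1/p')) * v ^ (1/p')))) ≤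
    (2^n * v * C) * M * (((2:ℝ) ^ (-d)) ^ m * 2 ^ (α * (k - m : ℤ))) := by
  have hone : 1/p + 1/p' = 1 := by simpa using hpp.inv_add_inv_eq_one
  have hv' : v ^ (1/p) * v ^ (1/p') = v := by
    rw [← Real.rpow_add hv, hone, Real.rpow_one]
  have h2 : (2:ℝ) ^ (α * k) * (2:ℝ) ^ ((n:ℝ) * (1 - k)) * (2:ℝ) ^ ((n:ℝ) * k * (1/p)) *
      (2:ℝ) ^ ((n:ℝ) * (k - m : ℤ) * (1/p')) * 2 ^ ((m:ℝ) * d) =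
      2^n * (((2:ℝ) ^ (-d)) ^ m * 2 ^ (α * (k - m : ℤ))) := by
    rw [← Real.rpow_natCast, ← Real.rpow_natCast, ← Real.rpow_mul (by norm_num)]
    simp only [← Real.rpow_add (zero_lt_two' ℝ)]
    congr 1
    have : 1/p = 1 - 1/p' := by linarith
    rw [this]
    push_cast
    linear_combination (m:ℝ) * hd
  calc _ = M * (v ^ (1/p) * v ^ (1/p')) * ((2:ℝ) ^ (α * k) * (2:ℝ) ^ ((n:ℝ) * (1 - k)) *
        (2:ℝ) ^ ((n:ℝ) * k * (1/p)) * (2:ℝ) ^ ((n:ℝ) * (k - m : ℤ) * (1/p'))) * (2 + m * 2^n) := by ring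
    _ ≤ M * (v ^ (1/p) * v ^ (1/p')) * ((2:ℝ) ^ (α * k) * (2:ℝ) ^ ((n:ℝ) * (1 - k)) *
        (2:ℝ) ^ ((n:ℝ) * k * (1/p)) * (2:ℝ) ^ ((n:ℝ) * (k - m : ℤ) * (1/p'))) *
          (C * 2 ^ ((m:ℝ) * d)) := by gcongr
    _ = M * (v ^ (1/p) * v ^ (1/p')) * C * ((2:ℝ) ^ (α * k) * (2:ℝ) ^ ((n:ℝ) * (1 - k)) *
        (2:ℝ) ^ ((n:ℝ) * k * (1/p)) * (2:ℝ) ^ ((n:ℝ) * (k - m : ℤ) * (1/p')) * 2 ^ ((m:ℝ) * d)) := by ring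
    _ = _ := by rw [h2, hv']; ring

/-- Let `1 < p < ∞`, `0 < q < ∞`, `α < n/p'` and
`b ∈ CBMO^{max(p,p')}(ℝⁿ)` with CBMO norm at most `M`. Then the commutator `[b,H]`
is bounded on the homogeneous Herz space `K̇^{α,q}_p(ℝⁿ)`. -/
theorem hardy_commutator_herz_bounded (n : ℕ) (hn : 0 < n) (p q α : ℝ)
    (hp : 1 < p) (hq : 0 < q) (hα : α < n * (1 - 1 / p)) :
    ∃ C : ℝ, 0 < C ∧
      ∀ (b : En n → ℝ) (M : ℝ), 0 ≤ M →
        (∀ r : ℝ, 0 < r → IntegrableOn b (ball (0 : En n) r) volume) →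
        (∀ r : ℝ, 0 < r →
          IntegrableOn
            (fun x => |b x - ⨍ y in ball (0 : En n) r, b y| ^ max p (p / (p - 1)))
            (ball (0 : En n) r) volume) →
        (∀ r : ℝ, 0 < r →
          ∫ x in ball (0 : En n) r,
              |b x - ⨍ y in ball (0 : En n) r, b y| ^ max p (p / (p - 1)) ≤
            M ^ max p (p / (p - 1)) * (volume (ball (0 : En n) r)).toReal) →
        ∀ f : En n → ℝ, Measurable f →
          herzNorm n α p q
              (fun x => b x * hardyOp n f x - hardyOp n (fun y => b y * f y) x) ≤
            ENNReal.ofReal (C * M) * herzNorm n α p q f := by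
  have hpp : p.HolderConjugate (p / (p - 1)) := Real.HolderConjugate.conjExponent hp
  set p' := p / (p - 1) with hp'
  have hone : 1/p + 1/p' = 1 := by simpa using hpp.inv_add_inv_eq_one
  obtain ⟨d, hd⟩ : ∃ d : ℝ, 2 * d = n * (1/p') - α := ⟨(n * (1/p') - α)/2, by ring⟩
  have hd0 : 0 < d := by
    have : 1/p' = 1 - 1/p := by linarith
    rw [this] at hd
    linarith
  obtain ⟨C', hC'0, hC'⟩ := poly_exp_bound n hd0
  have hr1 : ENNReal.ofReal ((2:ℝ) ^ (-d)) < 1 := by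
    rw [ENNReal.ofReal_lt_one]
    exact Real.rpow_lt_one_of_one_lt_of_neg (by norm_num) (by linarith)
  obtain ⟨K, hK, hconv⟩ := conv_bound _ hr1 q hq
  set v := (volume (ball (0 : En n) 1)).toReal with hv
  have hv0 : 0 < v := ENNReal.toReal_pos (measure_ball_pos _ _ one_pos).ne' measure_ball_lt_top.ne
  obtain ⟨D, hD⟩ : ∃ D : ℝ, D = 2^n * v * C' := ⟨_, rfl⟩
  have hD0 : 0 < D := by rw [hD]; positivity
  refine ⟨D * (K.toReal ^ (1/q) + 1), by positivity, ?_⟩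
  intro b M hM hb hbi hbM f hfm
  have hs1 : 1 ≤ max p p' := hp.le.trans (le_max_left _ _)
  have hL : ∀ r : ℝ, 1 ≤ r → r ≤ max p p' → ∀ k : ℤ,
      eLpNorm (fun x => b x - dyAvg b k) (ENNReal.ofReal r)
      (volume.restrict (ball (0 : En n) ((2:ℝ)^k))) ≤
        ENNReal.ofReal M * volume (ball (0 : En n) ((2:ℝ)^k)) ^ (1/r) := fun r h1 h2 k =>
    cbmo_bound hs1 hM (hb _ (by positivity)) (hbi _ (by positivity)) (hbM _ (by positivity)) r h1 h2
  have hLp := hL p hp.le (le_max_left _ _)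
  set T : En n → ℝ := fun x => b x * hardyOp n f x - hardyOp n (fun y => b y * f y) x with hT
  rcases hM.eq_or_lt with hM0 | hM0
  · have hz : ∀ k : ℤ, eLpNorm T (ENNReal.ofReal p) (volume.restrict (annulus n k)) = 0 := by
      intro k
      refine zero_case (c := dyAvg b k) (by linarith) k
        ((hb _ (by positivity)).aestronglyMeasurable.sub aestronglyMeasurable_const) ?_
      have := hLp k
      simpa [← hM0] using this
    have : herzNorm n α p q T = 0 := by
      simp [herzNorm, hz, hq]
    rw [this]
    exact zero_le
  have hstep := avg_step hM hb (fun k => by simpa using hL 1 le_rfl hs1 k)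
  set A : ℤ → ℝ≥0∞ := fun k => ENNReal.ofReal ((2 : ℝ) ^ (α * (k : ℝ))) *
      eLpNorm f (ENNReal.ofReal p) (volume.restrict (annulus n k)) with hA
  have hmain : ∀ k : ℤ, ENNReal.ofReal ((2 : ℝ) ^ (α * (k : ℝ))) *
      eLpNorm T (ENNReal.ofReal p) (volume.restrict (annulus n k)) ≤
      ENNReal.ofReal (D * M) * ∑' m : ℕ, ENNReal.ofReal ((2:ℝ) ^ (-d)) ^ m * A (k - m) := by
    intro k
    have h := annulus_bound hn hM0 hpp hfm hb k (hLp k)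
      (osc_small hM hpp.symm.lt.le hb hstep (hL p' hpp.symm.lt.le (le_max_right _ _)) k)
    refine (mul_le_mul_right h _).trans ?_
    rw [← ENNReal.tsum_mul_left, ← ENNReal.tsum_mul_left, ← ENNReal.tsum_mul_left]
    refine ENNReal.tsum_le_tsum fun m => ?_
    rw [vol_rpow n k hpp.one_div_nonneg, vol_rpow n (k-m) hpp.symm.one_div_nonneg, hA]
    set F := eLpNorm f (ENNReal.ofReal p) (volume.restrict (annulus n (k-m)))
    have hc := ENNReal.ofReal_le_ofReal
      (coeff_bound (α := α) (v := v) (M := M) hv0 hM hpp k m hd (hC' m))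
    rw [← hD] at hc
    repeat rw [ENNReal.ofReal_mul (by positivity)] at hc
    rw [ENNReal.ofReal_pow (by positivity : (0:ℝ) ≤ 2 ^ (-d))] at hc
    repeat rw [ENNReal.ofReal_mul (by positivity)]
    refine le_trans (le_of_eq ?_) ((mul_le_mul_left hc F).trans (le_of_eq ?_))
    · ring
    · ring
  have hsum : ∑' k : ℤ, (ENNReal.ofReal ((2 : ℝ) ^ (α * (k : ℝ))) *
      eLpNorm T (ENNReal.ofReal p) (volume.restrict (annulus n k))) ^ q ≤
      ENNReal.ofReal (D * M) ^ q * (K * ∑' k, A k ^ q) := by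
    refine (ENNReal.tsum_le_tsum fun k => ENNReal.rpow_le_rpow (hmain k) hq.le).trans ?_
    simp only [ENNReal.mul_rpow_of_nonneg (ENNReal.ofReal (D * M)) _ hq.le]
    rw [ENNReal.tsum_mul_left]
    gcongr
    exact hconv A
  have hq' : 0 ≤ 1/q := by positivity
  calc herzNorm n α p q T ≤ (ENNReal.ofReal (D * M) ^ q * (K * ∑' k, A k ^ q)) ^ (1/q) :=
        ENNReal.rpow_le_rpow hsum hq'
    _ = ENNReal.ofReal (D * M) * K ^ (1/q) * herzNorm n α p q f := by
        rw [ENNReal.mul_rpow_of_nonneg _ _ hq', ENNReal.mul_rpow_of_nonneg _ _ hq',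
          ← ENNReal.rpow_mul, mul_one_div_cancel hq.ne', ENNReal.rpow_one, ← mul_assoc]
        rfl
    _ ≤ _ := by
        gcongr
        rw [← ENNReal.ofReal_toReal hK, ENNReal.ofReal_rpow_of_nonneg ENNReal.toReal_nonneg hq',
          ← ENNReal.ofReal_mul (by positivity), ENNReal.toReal_ofReal ENNReal.toReal_nonneg]
        refine ENNReal.ofReal_le_ofReal ?_
        have : 0 < D * M := by positivity
        nlinarith
end

section
/- Let 1 < p < ∞, 1 < r < ∞, and b ∈ CBMO^{max(p,p')}(ℝⁿ). Then the vector-valued commutator inequality holds on L^p: ‖ ( Σ_{j=1}^∞ |[b,H]f_j|^r )^{1/r} ‖_{L^p(ℝⁿ)} ≤ C ‖ ( Σ_{j=1}^∞ |f_j|^r )^{1/r} ‖_{L^p(ℝⁿ)} for all sequences {f_j} with finite right-hand side. -/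
open MeasureTheory Metric ENNReal

lemma aux_minkowski {α : Type*} [MeasurableSpace α] (μ : Measure α) (r : ℝ) (hr : 1 < r)
    (g : ℕ → α → ℝ≥0∞) (hg : ∀ j, Measurable (g j)) :
    (∑' j, (∫⁻ y, g j y ∂μ) ^ r) ^ (1 / r) ≤ ∫⁻ y, (∑' j, (g j y) ^ r) ^ (1 / r) ∂μ := by
  have hr0 : 0 < r := by linarith
  have hc : r.HolderConjugate (r / (r - 1)) := Real.HolderConjugate.conjExponent hr
  set r' := r / (r - 1) with hr'
  have hr'0 : 0 < r' := hc.symm.pos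
  set G := ∫⁻ y, (∑' j, (g j y) ^ r) ^ (1 / r) ∂μ with hG
  have key : ∑' j, (∫⁻ y, g j y ∂μ) ^ r ≤ G ^ r := by
    apply ENNReal.tsum_le_of_sum_range_le
    intro N
    by_cases hGt : G = ∞
    · rw [hGt, ENNReal.top_rpow_of_pos hr0]; exact le_top
    have ha : ∀ j, ∫⁻ y, g j y ∂μ ≤ G := by
      intro j
      apply lintegral_mono
      intro y
      calc g j y = ((g j y) ^ r) ^ (1 / r) := by
            rw [← ENNReal.rpow_mul, mul_one_div_cancel hr0.ne', ENNReal.rpow_one]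
        _ ≤ _ := by
            exact ENNReal.rpow_le_rpow (ENNReal.le_tsum (f := fun j => (g j y) ^ r) j)
              (by positivity)
    set a : ℕ → ℝ≥0∞ := fun j => ∫⁻ y, g j y ∂μ with hadef
    have hat : ∀ j, a j ≠ ∞ := fun j => ne_top_of_le_ne_top hGt (ha j)
    set S := ∑ i ∈ Finset.range N, (a i) ^ r with hS
    have hSt : S ≠ ∞ := by
      rw [hS]
      exact (ENNReal.sum_lt_top.2 fun i _ => (ENNReal.rpow_lt_top_of_nonneg hr0.le (hat i))).ne
    by_cases hS0 : S = 0
    · rw [hS0]; exact zero_le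
    have h1 : S ≤ S ^ (1 / r') * G := by
      calc S = ∑ i ∈ Finset.range N, (a i) ^ (r - 1) * ∫⁻ y, g i y ∂μ := by
            rw [hS]
            refine Finset.sum_congr rfl fun i _ => ?_
            change a i ^ r = a i ^ (r - 1) * a i
            have : r = (r - 1) + 1 := by ring
            conv_lhs => rw [this, ENNReal.rpow_add_of_nonneg _ _ (by linarith) (by norm_num),
              ENNReal.rpow_one]
        _ = ∫⁻ y, ∑ i ∈ Finset.range N, (a i) ^ (r - 1) * g i y ∂μ := by
            rw [lintegral_finsetSum _ (fun i _ => (hg i).const_mul _)]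
            refine Finset.sum_congr rfl fun i _ => ?_
            rw [lintegral_const_mul _ (hg i)]
        _ ≤ ∫⁻ y, S ^ (1 / r') * (∑' j, (g j y) ^ r) ^ (1 / r) ∂μ := by
            apply lintegral_mono
            intro y
            refine (ENNReal.inner_le_Lp_mul_Lq _ _ _ hc.symm).trans ?_
            refine mul_le_mul' (ENNReal.rpow_le_rpow ?_ (by positivity))
              (ENNReal.rpow_le_rpow ?_ (by positivity))
            · apply le_of_eq
              refine Finset.sum_congr rfl fun i _ => ?_
              rw [← ENNReal.rpow_mul]
              congr 1
              rw [hr']; field_simp [(by linarith : r - 1 ≠ 0)]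
            · exact ENNReal.sum_le_tsum _
        _ = _ := by
            rw [lintegral_const_mul]
            exact (Measurable.tsum fun j => (hg j).pow_const _).pow_const _
    have h2 : S = S ^ (1 / r') * S ^ (1 / r) := by
      rw [← ENNReal.rpow_add _ _ hS0 hSt]
      have := hc.symm.inv_add_inv_eq_one
      rw [one_div, one_div, this, ENNReal.rpow_one]
    have h3 : S ^ (1 / r) ≤ G := by
      have h4 : S ^ (1 / r') * S ^ (1 / r) ≤ S ^ (1 / r') * G := by rw [← h2]; exact h1
      refine (ENNReal.mul_le_mul_iff_right ?_ ?_).1 h4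
      · intro h; rw [ENNReal.rpow_eq_zero_iff] at h
        rcases h with h | h
        · exact hS0 h.1
        · exact hSt h.1
      · exact (ENNReal.rpow_lt_top_of_nonneg (by positivity) hSt).ne
    calc S = (S ^ (1 / r)) ^ r := by
          rw [← ENNReal.rpow_mul, one_div_mul_cancel hr0.ne', ENNReal.rpow_one]
      _ ≤ G ^ r := by gcongr
  calc _ ≤ (G ^ r) ^ (1 / r) := by gcongr
    _ = G := by rw [← ENNReal.rpow_mul, mul_one_div_cancel hr0.ne', ENNReal.rpow_one]

lemma aux_conv (p : ℝ) (hp : 1 < p) (c : ℕ → ℝ≥0∞) (φ : ℤ → ℝ≥0∞) :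
    ∑' k : ℤ, (∑' m : ℕ, c m * φ (k - m)) ^ p ≤ (∑' m, c m) ^ p * ∑' k, φ k ^ p := by
  have hp0 : 0 < p := by linarith
  have hc : p.HolderConjugate (p / (p - 1)) := Real.HolderConjugate.conjExponent hp
  set p' := p / (p - 1) with hp'
  have hp'0 : 0 < p' := hc.symm.pos
  have hsum : 1 / p' + 1 / p = 1 := by
    have := hc.symm.inv_add_inv_eq_one
    rwa [one_div, one_div]
  set S := ∑' m, c m with hS
  have hk : ∀ k : ℤ, (∑' m : ℕ, c m * φ (k - m)) ^ p
      ≤ S ^ (p - 1) * ∑' m : ℕ, c m * φ (k - m) ^ p := by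
    intro k
    have h := ENNReal.lintegral_mul_le_Lp_mul_Lq (Measure.count : Measure ℕ) hc.symm
      (f := fun m => c m ^ (1 / p')) (g := fun m => c m ^ (1 / p) * φ (k - m))
      (measurable_of_countable _).aemeasurable (measurable_of_countable _).aemeasurable
    simp only [lintegral_count, Pi.mul_apply] at h
    have e1 : ∀ m : ℕ, c m ^ (1 / p') * (c m ^ (1 / p) * φ (k - m)) = c m * φ (k - m) := by
      intro m
      rw [← mul_assoc, ← ENNReal.rpow_add_of_nonneg _ _ (by positivity) (by positivity), hsum,
        ENNReal.rpow_one]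
    have e2 : ∀ m : ℕ, (c m ^ (1 / p')) ^ p' = c m := by
      intro m
      rw [← ENNReal.rpow_mul, one_div_mul_cancel hp'0.ne', ENNReal.rpow_one]
    have e3 : ∀ m : ℕ, (c m ^ (1 / p) * φ (k - m)) ^ p = c m * φ (k - m) ^ p := by
      intro m
      rw [ENNReal.mul_rpow_of_nonneg _ _ hp0.le, ← ENNReal.rpow_mul, one_div_mul_cancel hp0.ne',
        ENNReal.rpow_one]
    simp only [e1, e2, e3] at h
    calc _ ≤ _ := ENNReal.rpow_le_rpow h hp0.le
      _ = _ := by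
        rw [ENNReal.mul_rpow_of_nonneg _ _ hp0.le, ← ENNReal.rpow_mul, ← ENNReal.rpow_mul,
          one_div_mul_cancel hp0.ne', ENNReal.rpow_one]
        congr 2
        rw [hp']; field_simp [(by linarith : p - 1 ≠ 0)]
  calc _ ≤ ∑' k : ℤ, S ^ (p - 1) * ∑' m : ℕ, c m * φ (k - m) ^ p := ENNReal.tsum_le_tsum hk
    _ = S ^ (p - 1) * ∑' m : ℕ, ∑' k : ℤ, c m * φ (k - m) ^ p := by
        rw [ENNReal.tsum_mul_left, ENNReal.tsum_comm]
    _ = S ^ (p - 1) * ∑' m : ℕ, c m * ∑' k : ℤ, φ k ^ p := by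
        congr 2
        funext m
        rw [ENNReal.tsum_mul_left]
        congr 1
        exact (Equiv.subRight (m : ℤ)).tsum_eq (fun k => φ k ^ p)
    _ = S ^ (p - 1) * S * ∑' k : ℤ, φ k ^ p := by
        rw [ENNReal.tsum_mul_right, mul_assoc]
    _ = _ := by
        congr 1
        have : p = (p - 1) + 1 := by ring
        conv_rhs => rw [this, ENNReal.rpow_add_of_nonneg _ _ (by linarith) (by norm_num),
              ENNReal.rpow_one]

lemma aux_lower {α : Type*} [MeasurableSpace α] (μ : Measure α) [IsFiniteMeasure μ]
    (f : α → ℝ) (hf : Measurable f) (s q : ℝ) (hs : 0 < s) (hsq : s ≤ q) (M : ℝ≥0∞)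
    (h : ∫⁻ x, ‖f x‖ₑ ^ q ∂μ ≤ M ^ q * μ Set.univ) :
    ∫⁻ x, ‖f x‖ₑ ^ s ∂μ ≤ M ^ s * μ Set.univ := by
  have hq : 0 < q := by linarith
  by_cases h0 : μ Set.univ = 0
  · have : μ = 0 := Measure.measure_univ_eq_zero.1 h0
    simp [this]
  have h1 := eLpNorm'_le_eLpNorm'_mul_rpow_measure_univ (μ := μ) hs hsq hf.aestronglyMeasurable
  unfold eLpNorm' at h1
  have h2 : (∫⁻ x, ‖f x‖ₑ ^ s ∂μ) ^ (1 / s) ≤ M * μ Set.univ ^ (1 / s) := by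
    calc _ ≤ _ := h1
      _ ≤ (M ^ q * μ Set.univ) ^ (1 / q) * μ Set.univ ^ (1 / s - 1 / q) := by gcongr
      _ = M * μ Set.univ ^ (1 / s) := by
        rw [ENNReal.mul_rpow_of_nonneg _ _ (by positivity), ← ENNReal.rpow_mul,
          mul_one_div_cancel hq.ne', ENNReal.rpow_one, mul_assoc,
          ← ENNReal.rpow_add _ _ h0 (measure_ne_top _ _)]
        congr 2; ring
  calc _ = ((∫⁻ x, ‖f x‖ₑ ^ s ∂μ) ^ (1 / s)) ^ s := by
        rw [← ENNReal.rpow_mul, one_div_mul_cancel hs.ne', ENNReal.rpow_one]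
    _ ≤ (M * μ Set.univ ^ (1 / s)) ^ s := by gcongr
    _ = _ := by
      rw [ENNReal.mul_rpow_of_nonneg _ _ hs.le, ← ENNReal.rpow_mul, one_div_mul_cancel hs.ne',
        ENNReal.rpow_one]

/-- Dyadic annuli. -/
def aAnn (n : ℕ) (k : ℤ) : Set (En n) := {x | (2 : ℝ) ^ k ≤ ‖x‖ ∧ ‖x‖ < (2 : ℝ) ^ (k + 1)}

/-- Dyadic balls. -/
def aBall (n : ℕ) (k : ℤ) : Set (En n) := ball (0 : En n) ((2 : ℝ) ^ (k + 1))

lemma aAnn_meas (n : ℕ) (k : ℤ) : MeasurableSet (aAnn n k) :=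
  (measurableSet_le measurable_const measurable_norm).inter
    (measurableSet_lt measurable_norm measurable_const)

lemma aAnn_sub (n : ℕ) (k : ℤ) : aAnn n k ⊆ aBall n k := by
  intro x hx
  simpa [aBall] using hx.2

lemma aBall_mono (n : ℕ) {k l : ℤ} (h : k ≤ l) : aBall n k ⊆ aBall n l := by
  apply ball_subset_ball
  exact zpow_le_zpow_right₀ (by norm_num) (by linarith)

lemma aAnn_disj (n : ℕ) : Pairwise (Function.onFun Disjoint (aAnn n)) := by
  intro k l hkl
  rw [Function.onFun, Set.disjoint_left]
  rintro x ⟨h1, h2⟩ ⟨h3, h4⟩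
  have a1 : k < l + 1 := (zpow_lt_zpow_iff_right₀ (by norm_num : (1 : ℝ) < 2)).1 (h1.trans_lt h4)
  have a2 : l < k + 1 := (zpow_lt_zpow_iff_right₀ (by norm_num : (1 : ℝ) < 2)).1 (h3.trans_lt h2)
  omega

lemma aAnn_exists (n : ℕ) (x : En n) (hx : x ≠ 0) : ∃ k, x ∈ aAnn n k := by
  obtain ⟨k, hk⟩ := exists_mem_Ico_zpow (norm_pos_iff.2 hx) (by norm_num : (1 : ℝ) < 2)
  exact ⟨k, hk.1, hk.2⟩

lemma aBall_cover (n : ℕ) (k : ℤ) :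
    aBall n k ⊆ {0} ∪ ⋃ m : ℕ, aAnn n (k - m) := by
  intro x hx
  by_cases h0 : x = 0
  · left; exact h0
  right
  obtain ⟨l, hl⟩ := aAnn_exists n x h0
  have hx2 : ‖x‖ < (2 : ℝ) ^ (k + 1) := by simpa [aBall] using hx
  have a1 : l < k + 1 := (zpow_lt_zpow_iff_right₀ (by norm_num : (1 : ℝ) < 2)).1 (hl.1.trans_lt hx2)
  rw [Set.mem_iUnion]
  refine ⟨(k - l).toNat, ?_⟩
  have : k - ((k - l).toNat : ℤ) = l := by omega
  rwa [this]

lemma aBall_succ (n : ℕ) (hn : 0 < n) (k : ℤ) :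
    volume (aBall n (k + 1)) = 2 ^ n * volume (aBall n k) := by
  have : Nonempty (Fin n) := ⟨⟨0, hn⟩⟩
  unfold aBall
  rw [Measure.addHaar_ball volume (0 : En n) (r := (2 : ℝ) ^ (k + 1 + 1)) (by positivity),
    Measure.addHaar_ball volume (0 : En n) (r := (2 : ℝ) ^ (k + 1)) (by positivity),
    ← mul_assoc]
  congr 1
  rw [finrank_euclideanSpace_fin, zpow_add_one₀ (by norm_num) (k + 1), mul_pow,
    ENNReal.ofReal_mul (by positivity), mul_comm]
  congr 1
  rw [ENNReal.ofReal_pow (by norm_num)]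
  norm_num

lemma aBall_pos (n : ℕ) (k : ℤ) : volume (aBall n k) ≠ 0 :=
  (measure_ball_pos _ _ (by positivity)).ne'

lemma aBall_fin (n : ℕ) (k : ℤ) : volume (aBall n k) ≠ ∞ := measure_ball_lt_top.ne

lemma aNorm_le (n : ℕ) (hn : 0 < n) (k : ℤ) (x : En n) (hx : x ∈ aAnn n k) :
    ENNReal.ofReal (‖x‖ ^ (-(n : ℝ))) ≤
      (2 ^ n * volume (ball (0 : En n) 1)) * (volume (aBall n k))⁻¹ := by
  have : Nonempty (Fin n) := ⟨⟨0, hn⟩⟩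
  have hpos : (0 : ℝ) < 2 ^ k := by positivity
  have hxp : 0 < ‖x‖ := hpos.trans_le hx.1
  rw [← div_eq_mul_inv, ENNReal.le_div_iff_mul_le (Or.inl (aBall_pos n k)) (Or.inl (aBall_fin n k))]
  unfold aBall
  rw [Measure.addHaar_ball _ _ (by positivity), ← mul_assoc, finrank_euclideanSpace_fin]
  gcongr
  rw [← ENNReal.ofReal_mul (by positivity), zpow_add_one₀ (by norm_num), mul_pow]
  have : (2 : ℝ≥0∞) ^ n = ENNReal.ofReal (2 ^ n) := by
    rw [ENNReal.ofReal_pow (by norm_num)]; norm_num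
  rw [this]
  apply ENNReal.ofReal_le_ofReal
  rw [Real.rpow_neg hxp.le, Real.rpow_natCast, ← mul_assoc]
  have h1 : (‖x‖ ^ n)⁻¹ * (2 ^ k) ^ n ≤ (1 : ℝ) := by
    rw [inv_mul_le_iff₀ (by positivity), mul_one]
    exact pow_le_pow_left₀ hpos.le hx.1 n
  calc _ ≤ 1 * (2 : ℝ) ^ n := by gcongr
    _ = _ := one_mul _

lemma aJump (n : ℕ) (hn : 0 < n) (b : En n → ℝ) (hb : Measurable b) (β : ℤ → ℝ) (M : ℝ≥0∞)
    (h1 : ∀ k, ∫⁻ x in aBall n k, ‖b x - β k‖ₑ ≤ M * volume (aBall n k)) (k : ℤ) (m : ℕ) :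
    ‖β k - β (k - m)‖ₑ ≤ m * ((2 ^ n + 1) * M) := by
  have step : ∀ k, ‖β (k + 1) - β k‖ₑ ≤ (2 ^ n + 1) * M := by
    intro k
    have h : ‖β (k + 1) - β k‖ₑ * volume (aBall n k) ≤ ((2 ^ n + 1) * M) * volume (aBall n k) := by
      calc _ = ∫⁻ x in aBall n k, ‖β (k + 1) - β k‖ₑ := by rw [setLIntegral_const]
        _ ≤ ∫⁻ x in aBall n k, (‖b x - β (k + 1)‖ₑ + ‖b x - β k‖ₑ) := by
          apply lintegral_mono
          intro x
          have : β (k + 1) - β k = (b x - β k) - (b x - β (k + 1)) := by ring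
          simp only
          rw [this, sub_eq_add_neg (b x - β k)]
          refine (enorm_add_le _ _).trans ?_
          rw [enorm_neg]
          exact (add_comm _ _).le
        _ = (∫⁻ x in aBall n k, ‖b x - β (k + 1)‖ₑ) + ∫⁻ x in aBall n k, ‖b x - β k‖ₑ := by
          rw [lintegral_add_left]
          exact (hb.sub_const _).enorm
        _ ≤ M * volume (aBall n (k + 1)) + M * volume (aBall n k) := by
          refine add_le_add ?_ (h1 k)
          exact (lintegral_mono_set (aBall_mono n (by omega))).trans (h1 (k + 1))
        _ = _ := by rw [aBall_succ n hn]; ring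
    exact (ENNReal.mul_le_mul_iff_left (aBall_pos n k) (aBall_fin n k)).1 h
  induction m with
  | zero => simp
  | succ m ih =>
    have e : β k - β (k - (m + 1 : ℕ)) =
        (β k - β (k - m)) + (β ((k - (m + 1 : ℕ)) + 1) - β (k - (m + 1 : ℕ))) := by
      have : (k - ((m + 1 : ℕ) : ℤ)) + 1 = k - m := by push_cast; ring
      rw [this]; ring
    rw [e]
    calc _ ≤ _ := enorm_add_le _ _
      _ ≤ m * ((2 ^ n + 1) * M) + (2 ^ n + 1) * M := add_le_add ih (step _)
      _ = _ := by push_cast; ring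

lemma aVol (n : ℕ) (hn : 0 < n) (t : ℝ) (ht : 0 < t) (k : ℤ) (m : ℕ) :
    volume (aBall n (k - m)) ^ t = (((2 : ℝ≥0∞) ^ n) ^ (-t)) ^ m * volume (aBall n k) ^ t := by
  induction m with
  | zero => simp
  | succ m ih =>
    have h := aBall_succ n hn (k - (m + 1 : ℕ))
    have e : (k - ((m + 1 : ℕ) : ℤ)) + 1 = k - m := by push_cast; ring
    rw [e] at h
    rw [h, ENNReal.mul_rpow_of_nonneg _ _ ht.le] at ih
    rw [pow_succ', mul_assoc, ← ih, ← mul_assoc, ← ENNReal.rpow_add _ _ (by simp) (by simp)]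
    simp

/-- The coefficients of the discrete convolution. -/
noncomputable def aC (n : ℕ) (p' : ℝ) (m : ℕ) : ℝ≥0∞ :=
  (((2 : ℝ≥0∞) ^ n) ^ (-(1 / p'))) ^ m * (m * (2 ^ n + 1) + 1)

lemma aC_sum (n : ℕ) (hn : 0 < n) (p' : ℝ) (hp' : 0 < p') : ∑' m, aC n p' m ≠ ∞ := by
  set t : ℝ := ((2 : ℝ) ^ n) ^ (-(1 / p')) with ht
  have h2n : (1 : ℝ) < 2 ^ n := one_lt_pow₀ (by norm_num) hn.ne'
  have ht0 : 0 < t := by positivity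
  have ht1 : t < 1 := Real.rpow_lt_one_of_one_lt_of_neg h2n (by
    have : 0 < 1 / p' := by positivity
    linarith)
  have e : ∀ m, aC n p' m = ENNReal.ofReal (t ^ m * (m * (2 ^ n + 1) + 1)) := by
    intro m
    unfold aC
    have e2 : (2 : ℝ≥0∞) ^ n = ENNReal.ofReal (2 ^ n) := by
      rw [ENNReal.ofReal_pow (by norm_num)]; norm_num
    rw [ENNReal.ofReal_mul (by positivity), ENNReal.ofReal_pow ht0.le, ht,
      ← ENNReal.ofReal_rpow_of_pos (by positivity), ← e2,
      ENNReal.ofReal_add (by positivity) (by positivity), ENNReal.ofReal_mul (by positivity),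
      ENNReal.ofReal_add (by positivity) (by positivity), ← e2]
    simp
  have hs : Summable fun m : ℕ => t ^ m * ((m : ℝ) * (2 ^ n + 1) + 1) := by
    have s1 := summable_pow_mul_geometric_of_norm_lt_one 1 (r := t)
      (by rw [Real.norm_of_nonneg ht0.le]; exact ht1)
    have s2 := summable_geometric_of_lt_one ht0.le ht1
    refine ((s1.mul_right (2 ^ n + 1)).add s2).congr fun m => ?_
    ring
  simp_rw [e]
  exact hs.tsum_ofReal_ne_top

lemma aInner (n : ℕ) (hn : 0 < n) (p p' : ℝ) (hc : p.HolderConjugate p')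
    (b : En n → ℝ) (hb : Measurable b) (β : ℤ → ℝ) (M : ℝ≥0∞)
    (h1 : ∀ k, ∫⁻ x in aBall n k, ‖b x - β k‖ₑ ≤ M * volume (aBall n k))
    (h2 : ∀ k, ∫⁻ x in aBall n k, ‖b x - β k‖ₑ ^ p' ≤ M ^ p' * volume (aBall n k))
    (F : En n → ℝ≥0∞) (hF : Measurable F) (k : ℤ) (m : ℕ) (x : En n) :
    ∫⁻ y in aAnn n (k - m), ‖b x - b y‖ₑ * F y ≤
      ((‖b x - β k‖ₑ + M) * volume (aBall n k) ^ (1 / p')) *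
        (aC n p' m * (∫⁻ y in aAnn n (k - m), F y ^ p) ^ (1 / p)) := by
  have hp' : 0 < p' := hc.symm.pos
  set i := k - (m : ℤ) with hi
  set φ := (∫⁻ y in aAnn n i, F y ^ p) ^ (1 / p) with hφ
  set V := volume (aBall n i) ^ (1 / p') with hV
  have hF1 : ∫⁻ y in aAnn n i, F y ≤ V * φ := by
    have := ENNReal.lintegral_mul_le_Lp_mul_Lq (volume.restrict (aAnn n i)) hc.symm
      (f := fun _ => 1) (g := F) measurable_const.aemeasurable hF.aemeasurable
    simp only [Pi.mul_apply, one_mul, ENNReal.one_rpow, setLIntegral_const] at this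
    refine this.trans ?_
    exact mul_le_mul' (ENNReal.rpow_le_rpow (measure_mono (aAnn_sub n i)) (by positivity)) le_rfl
  have hF2 : ∫⁻ y in aAnn n i, ‖b y - β i‖ₑ * F y ≤ M * V * φ := by
    have := ENNReal.lintegral_mul_le_Lp_mul_Lq (volume.restrict (aAnn n i)) hc.symm
      (f := fun y => ‖b y - β i‖ₑ) (g := F) (hb.sub_const _).enorm.aemeasurable hF.aemeasurable
    simp only [Pi.mul_apply] at this
    refine this.trans (mul_le_mul' ?_ le_rfl)
    calc _ ≤ (M ^ p' * volume (aBall n i)) ^ (1 / p') :=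
          ENNReal.rpow_le_rpow ((lintegral_mono_set (aAnn_sub n i)).trans (h2 i)) (by positivity)
      _ = _ := by
        rw [ENNReal.mul_rpow_of_nonneg _ _ (by positivity), ← ENNReal.rpow_mul,
          mul_one_div_cancel hp'.ne', ENNReal.rpow_one]
  have hJ := aJump n hn b hb β M h1 k m
  calc _ ≤ ∫⁻ y in aAnn n i, ((‖b x - β k‖ₑ + ‖β k - β i‖ₑ) * F y + ‖b y - β i‖ₑ * F y) := by
        apply lintegral_mono
        intro y
        simp only
        rw [← add_mul]
        refine mul_le_mul' ?_ le_rfl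
        have : b x - b y = (b x - β k) + (β k - β i) + -(b y - β i) := by ring
        rw [this]
        refine (enorm_add_le _ _).trans ?_
        rw [enorm_neg]
        exact add_le_add (enorm_add_le _ _) le_rfl
    _ = (‖b x - β k‖ₑ + ‖β k - β i‖ₑ) * (∫⁻ y in aAnn n i, F y)
        + ∫⁻ y in aAnn n i, ‖b y - β i‖ₑ * F y := by
        rw [lintegral_add_left (hF.const_mul _), lintegral_const_mul _ hF]
    _ ≤ (‖b x - β k‖ₑ + m * ((2 ^ n + 1) * M)) * (V * φ) + M * V * φ :=
        add_le_add (mul_le_mul' (add_le_add le_rfl hJ) hF1) hF2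
    _ = (‖b x - β k‖ₑ + m * ((2 ^ n + 1) * M) + M) * (V * φ) := by ring
    _ ≤ ((m * (2 ^ n + 1) + 1) * (‖b x - β k‖ₑ + M)) * (V * φ) := by
        refine mul_le_mul' ?_ le_rfl
        calc _ ≤ ‖b x - β k‖ₑ + m * ((2 ^ n + 1) * M) + M + m * (2 ^ n + 1) * ‖b x - β k‖ₑ :=
              le_self_add
          _ = _ := by ring
    _ = _ := by
        rw [hV, hi, aVol n hn (1 / p') (by positivity) k m]
        unfold aC
        ring

lemma aCore (n : ℕ) (hn : 0 < n) (p p' : ℝ) (hc : p.HolderConjugate p')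
    (b : En n → ℝ) (hb : Measurable b) (β : ℤ → ℝ) (M : ℝ≥0∞)
    (h1 : ∀ k, ∫⁻ x in aBall n k, ‖b x - β k‖ₑ ≤ M * volume (aBall n k))
    (h2 : ∀ k, ∫⁻ x in aBall n k, ‖b x - β k‖ₑ ^ p' ≤ M ^ p' * volume (aBall n k))
    (h3 : ∀ k, ∫⁻ x in aBall n k, ‖b x - β k‖ₑ ^ p ≤ M ^ p * volume (aBall n k))
    (F : En n → ℝ≥0∞) (hF : Measurable F) :
    ∫⁻ x, (ENNReal.ofReal (‖x‖ ^ (-(n : ℝ))) *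
        ∫⁻ y in closedBall (0 : En n) ‖x‖, ‖b x - b y‖ₑ * F y) ^ p ≤
      (2 * (2 ^ n * volume (ball (0 : En n) 1)) * (∑' m, aC n p' m) * M) ^ p *
        ∫⁻ y, F y ^ p := by
  have : Nonempty (Fin n) := ⟨⟨0, hn⟩⟩
  have hp' : 0 < p' := hc.symm.pos
  have hp : 0 < p := hc.pos
  have hp1 : 1 < p := hc.lt
  set Λ := 2 ^ n * volume (ball (0 : En n) 1) with hΛ
  set T : En n → ℝ≥0∞ := fun x => ENNReal.ofReal (‖x‖ ^ (-(n : ℝ))) *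
        ∫⁻ y in closedBall (0 : En n) ‖x‖, ‖b x - b y‖ₑ * F y with hT
  set φ : ℤ → ℝ≥0∞ := fun i => (∫⁻ y in aAnn n i, F y ^ p) ^ (1 / p) with hφ
  set A : ℤ → ℝ≥0∞ := fun k => ∑' m : ℕ, aC n p' m * φ (k - m) with hA
  have hpt : ∀ k, ∀ x ∈ aAnn n k, T x ≤
      (Λ * (volume (aBall n k))⁻¹ * volume (aBall n k) ^ (1 / p') * A k) *
        (‖b x - β k‖ₑ + M) := by
    intro k x hx
    have hsub : closedBall (0 : En n) ‖x‖ ⊆ {0} ∪ ⋃ m : ℕ, aAnn n (k - m) :=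
      (closedBall_subset_ball hx.2).trans (aBall_cover n k)
    have hI : ∫⁻ y in closedBall (0 : En n) ‖x‖, ‖b x - b y‖ₑ * F y ≤
        ((‖b x - β k‖ₑ + M) * volume (aBall n k) ^ (1 / p')) * A k := by
      calc _ ≤ _ := lintegral_mono_set hsub
        _ ≤ _ := lintegral_union_le _ _ _
        _ = ∫⁻ y in ⋃ m : ℕ, aAnn n (k - m), ‖b x - b y‖ₑ * F y := by
          rw [setLIntegral_measure_zero _ _ (by simp), zero_add]
        _ ≤ _ := lintegral_iUnion_le _ _
        _ ≤ _ := ENNReal.tsum_le_tsum fun m => aInner n hn p p' hc b hb β M h1 h2 F hF k m x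
        _ = _ := ENNReal.tsum_mul_left
    calc T x ≤ (Λ * (volume (aBall n k))⁻¹) *
          (((‖b x - β k‖ₑ + M) * volume (aBall n k) ^ (1 / p')) * A k) :=
          mul_le_mul' (aNorm_le n hn k x hx) hI
      _ = _ := by ring
  have hk : ∀ k, ∫⁻ x in aAnn n k, T x ^ p ≤ (2 * Λ * M) ^ p * A k ^ p := by
    intro k
    set v := volume (aBall n k) with hv
    have hv0 : v ≠ 0 := aBall_pos n k
    have hvt : v ≠ ∞ := aBall_fin n k
    calc _ ≤ ∫⁻ x in aAnn n k, (Λ * v⁻¹ * v ^ (1 / p') * A k) ^ p *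
            (‖b x - β k‖ₑ + M) ^ p := by
          apply setLIntegral_mono' (aAnn_meas n k)
          intro x hx
          rw [← ENNReal.mul_rpow_of_nonneg _ _ hp.le]
          exact ENNReal.rpow_le_rpow (hpt k x hx) hp.le
      _ = (Λ * v⁻¹ * v ^ (1 / p') * A k) ^ p * ∫⁻ x in aAnn n k, (‖b x - β k‖ₑ + M) ^ p := by
          rw [lintegral_const_mul]
          exact ((hb.sub_const _).enorm.add_const _).pow_const _
      _ ≤ (Λ * v⁻¹ * v ^ (1 / p') * A k) ^ p * (2 ^ p * M ^ p * v) := by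
          refine mul_le_mul' le_rfl ?_
          calc _ ≤ _ := lintegral_mono_set (aAnn_sub n k)
            _ ≤ ∫⁻ x in aBall n k, 2 ^ (p - 1) * (‖b x - β k‖ₑ ^ p + M ^ p) :=
              lintegral_mono fun x => ENNReal.rpow_add_le_mul_rpow_add_rpow _ _ hp1.le
            _ = 2 ^ (p - 1) * ((∫⁻ x in aBall n k, ‖b x - β k‖ₑ ^ p) + M ^ p * v) := by
              rw [lintegral_const_mul, lintegral_add_right _ measurable_const, setLIntegral_const]
              exact ((hb.sub_const _).enorm.pow_const _).add_const _
            _ ≤ 2 ^ (p - 1) * (M ^ p * v + M ^ p * v) := by gcongr; exact h3 k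
            _ = (2 ^ (p - 1) * 2 ^ (1 : ℝ)) * M ^ p * v := by rw [ENNReal.rpow_one]; ring
            _ = _ := by
              rw [← ENNReal.rpow_add _ _ (by norm_num) (by norm_num)]
              congr 3; ring
      _ = (2 * Λ * M) ^ p * A k ^ p * ((v⁻¹ * v ^ (1 / p')) ^ p * v) := by
          simp only [ENNReal.mul_rpow_of_nonneg _ _ hp.le]
          ring
      _ = (2 * Λ * M) ^ p * A k ^ p := by
          have : (v⁻¹ * v ^ (1 / p')) ^ p * v = 1 := by
            rw [← ENNReal.rpow_neg_one, ← ENNReal.rpow_add _ _ hv0 hvt, ← ENNReal.rpow_mul]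
            nth_rewrite 2 [← ENNReal.rpow_one v]
            rw [← ENNReal.rpow_add _ _ hv0 hvt]
            have e := hc.symm.inv_add_inv_eq_one
            have : (-1 + 1 / p') * p + 1 = 0 := by
              have : 1 / p' = 1 - p⁻¹ := by rw [one_div]; linarith
              rw [this]; field_simp; ring
            rw [this, ENNReal.rpow_zero]
          rw [this, mul_one]
  have hcov : (Set.univ : Set (En n)) ⊆ {0} ∪ ⋃ k : ℤ, aAnn n k := by
    intro x _
    by_cases h0 : x = 0
    · left; exact h0
    · right; exact Set.mem_iUnion.2 (aAnn_exists n x h0)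
  calc ∫⁻ x, T x ^ p = ∫⁻ x in Set.univ, T x ^ p := by rw [Measure.restrict_univ]
    _ ≤ _ := lintegral_mono_set hcov
    _ ≤ _ := lintegral_union_le _ _ _
    _ = ∫⁻ x in ⋃ k : ℤ, aAnn n k, T x ^ p := by
        rw [setLIntegral_measure_zero _ _ (by simp), zero_add]
    _ ≤ _ := lintegral_iUnion_le _ _
    _ ≤ ∑' k : ℤ, (2 * Λ * M) ^ p * A k ^ p := ENNReal.tsum_le_tsum hk
    _ = (2 * Λ * M) ^ p * ∑' k : ℤ, A k ^ p := ENNReal.tsum_mul_left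
    _ ≤ (2 * Λ * M) ^ p * ((∑' m, aC n p' m) ^ p * ∑' k, φ k ^ p) :=
        mul_le_mul' le_rfl (aux_conv p hp1 _ _)
    _ ≤ (2 * Λ * M) ^ p * ((∑' m, aC n p' m) ^ p * ∫⁻ y, F y ^ p) := by
        refine mul_le_mul' le_rfl (mul_le_mul' le_rfl ?_)
        have e : ∀ k, φ k ^ p = ∫⁻ y in aAnn n k, F y ^ p := by
          intro k
          simp only [hφ]
          rw [← ENNReal.rpow_mul, one_div_mul_cancel hp.ne', ENNReal.rpow_one]
        simp_rw [e]
        rw [← lintegral_iUnion (aAnn_meas n) (aAnn_disj n)]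
        exact setLIntegral_le_lintegral _ _
    _ = _ := by
        simp only [ENNReal.mul_rpow_of_nonneg _ _ hp.le]
        ring

lemma aPoint (n : ℕ) (r : ℝ) (hr : 1 < r) (b : En n → ℝ) (hb : Measurable b)
    (f : ℕ → En n → ℝ) (hf : ∀ j, Measurable (f j)) (x : En n)
    (hi : ∀ j, IntegrableOn (f j) (closedBall (0 : En n) ‖x‖) volume)
    (hbi : ∀ j, IntegrableOn (fun y => b y * f j y) (closedBall (0 : En n) ‖x‖) volume) :
    (∑' j : ℕ, (ENNReal.ofReal
        |b x * hardyOp n (f j) x - hardyOp n (fun y => b y * f j y) x|) ^ r) ^ (1 / r) ≤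
      ENNReal.ofReal (‖x‖ ^ (-(n : ℝ))) * ∫⁻ y in closedBall (0 : En n) ‖x‖,
        ‖b x - b y‖ₑ * (∑' j : ℕ, (ENNReal.ofReal |f j y|) ^ r) ^ (1 / r) := by
  have hr0 : 0 < r := by linarith
  set w := ENNReal.ofReal (‖x‖ ^ (-(n : ℝ))) with hw
  have hw0 : 0 ≤ ‖x‖ ^ (-(n : ℝ)) := by positivity
  set g : ℕ → En n → ℝ≥0∞ := fun j y => ‖b x - b y‖ₑ * ENNReal.ofReal |f j y| with hg
  have hgm : ∀ j, Measurable (g j) := fun j =>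
    (measurable_const.sub hb).enorm.mul (hf j).abs.ennreal_ofReal
  have h1 : ∀ j, ENNReal.ofReal
        |b x * hardyOp n (f j) x - hardyOp n (fun y => b y * f j y) x| ≤
      w * ∫⁻ y in closedBall (0 : En n) ‖x‖, g j y := by
    intro j
    have e : b x * hardyOp n (f j) x - hardyOp n (fun y => b y * f j y) x =
        ‖x‖ ^ (-(n : ℝ)) * ∫ y in closedBall (0 : En n) ‖x‖, (b x - b y) * f j y := by
      unfold hardyOp
      have : ∫ y in closedBall (0 : En n) ‖x‖, (b x - b y) * f j y =
          b x * (∫ y in closedBall (0 : En n) ‖x‖, f j y) -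
            ∫ y in closedBall (0 : En n) ‖x‖, b y * f j y := by
        rw [← integral_const_mul, ← integral_sub ((hi j).const_mul _) (hbi j)]
        congr 1
        funext y
        ring
      rw [this]; ring
    rw [e, abs_mul, abs_of_nonneg hw0, ENNReal.ofReal_mul hw0, ← Real.enorm_eq_ofReal_abs]
    refine mul_le_mul' le_rfl ((enorm_integral_le_lintegral_enorm _).trans (le_of_eq ?_))
    congr 1
    funext y
    simp only [hg]
    rw [enorm_mul, Real.enorm_eq_ofReal_abs (f j y)]
  calc _ ≤ (∑' j, (w * ∫⁻ y in closedBall (0 : En n) ‖x‖, g j y) ^ r) ^ (1 / r) :=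
        ENNReal.rpow_le_rpow (ENNReal.tsum_le_tsum fun j => ENNReal.rpow_le_rpow (h1 j) hr0.le)
          (by positivity)
    _ = w * (∑' j, (∫⁻ y in closedBall (0 : En n) ‖x‖, g j y) ^ r) ^ (1 / r) := by
        simp_rw [ENNReal.mul_rpow_of_nonneg _ _ hr0.le]
        rw [ENNReal.tsum_mul_left, ENNReal.mul_rpow_of_nonneg _ _ (by positivity),
          ← ENNReal.rpow_mul, mul_one_div_cancel hr0.ne', ENNReal.rpow_one]
    _ ≤ w * ∫⁻ y in closedBall (0 : En n) ‖x‖, (∑' j, (g j y) ^ r) ^ (1 / r) :=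
        mul_le_mul' le_rfl (aux_minkowski _ r hr g hgm)
    _ = _ := by
        congr 2
        funext y
        simp only [hg]
        simp_rw [ENNReal.mul_rpow_of_nonneg _ _ hr0.le]
        rw [ENNReal.tsum_mul_left, ENNReal.mul_rpow_of_nonneg _ _ (by positivity),
          ← ENNReal.rpow_mul, mul_one_div_cancel hr0.ne', ENNReal.rpow_one]

/-- For `1 < p < ∞`, `1 < r < ∞` and `b ∈ CBMO^{max(p,p')}(ℝⁿ)`
(with CBMO norm at most `M`), the vector-valued commutator inequality
`‖(Σ_j |[b,H]f_j|^r)^{1/r}‖_{L^p} ≤ C M ‖(Σ_j |f_j|^r)^{1/r}‖_{L^p}` holds. -/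
theorem hardy_commutator_vector_valued (n : ℕ) (hn : 0 < n) (p r : ℝ)
    (hp : 1 < p) (hr : 1 < r) :
    ∃ C : ℝ, 0 < C ∧
      ∀ (b : En n → ℝ) (M : ℝ), 0 ≤ M →
        (∀ ρ : ℝ, 0 < ρ → IntegrableOn b (ball (0 : En n) ρ) volume) →
        (∀ ρ : ℝ, 0 < ρ →
          IntegrableOn
            (fun x => |b x - ⨍ y in ball (0 : En n) ρ, b y| ^ max p (p / (p - 1)))
            (ball (0 : En n) ρ) volume) →
        (∀ ρ : ℝ, 0 < ρ →
          ∫ x in ball (0 : En n) ρ,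
              |b x - ⨍ y in ball (0 : En n) ρ, b y| ^ max p (p / (p - 1)) ≤
            M ^ max p (p / (p - 1)) * (volume (ball (0 : En n) ρ)).toReal) →
        ∀ f : ℕ → En n → ℝ, (∀ j, Measurable (f j)) → Measurable b →
          (∫⁻ x, ((∑' j : ℕ,
              (ENNReal.ofReal
                |b x * hardyOp n (f j) x - hardyOp n (fun y => b y * f j y) x|) ^ r) ^
                (1 / r)) ^ p) ^ (1 / p) ≤
            ENNReal.ofReal (C * M) *
              (∫⁻ x, ((∑' j : ℕ, (ENNReal.ofReal |f j x|) ^ r) ^ (1 / r)) ^ p) ^ (1 / p) := by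
  
  have hp0 : 0 < p := by linarith
  have hr0 : 0 < r := by linarith
  have hc : p.HolderConjugate (p / (p - 1)) := Real.HolderConjugate.conjExponent hp
  set p' := p / (p - 1) with hp'
  have hp'0 : 0 < p' := hc.symm.pos
  set q := max p p' with hq
  have hq0 : 0 < q := lt_max_of_lt_left hp0
  set Λ : ℝ≥0∞ := 2 * (2 ^ n * volume (ball (0 : En n) 1)) * (∑' m, aC n p' m) with hΛ
  have hΛt : Λ ≠ ∞ := by
    refine ENNReal.mul_ne_top (ENNReal.mul_ne_top (by simp) (ENNReal.mul_ne_top (by simp)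
      measure_ball_lt_top.ne)) (aC_sum n hn p' hp'0)
  refine ⟨Λ.toReal + 1, by positivity, ?_⟩
  intro b M hM hbi hbq hbM f hf hb
  set β : ℤ → ℝ := fun k => ⨍ y in aBall n k, b y with hβ
  have hQ : ∀ k, ∫⁻ x in aBall n k, ‖b x - β k‖ₑ ^ q ≤
      ENNReal.ofReal M ^ q * volume (aBall n k) := by
    intro k
    have hρ : (0 : ℝ) < 2 ^ (k + 1) := by positivity
    have e := ofReal_integral_eq_lintegral_ofReal (hbq _ hρ)
      (Filter.Eventually.of_forall fun x => by positivity)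
    have e2 : ∫⁻ x in aBall n k, ‖b x - β k‖ₑ ^ q = ∫⁻ x in ball (0 : En n) (2 ^ (k + 1)),
        ENNReal.ofReal (|b x - ⨍ y in ball (0 : En n) (2 ^ (k + 1)), b y| ^ q) := by
      refine lintegral_congr fun x => ?_
      rw [← ENNReal.ofReal_rpow_of_nonneg (abs_nonneg _) hq0.le, Real.enorm_eq_ofReal_abs]
      rfl
    rw [e2, ← e]
    refine (ENNReal.ofReal_le_ofReal (hbM _ hρ)).trans (le_of_eq ?_)
    rw [ENNReal.ofReal_mul (by positivity), ENNReal.ofReal_toReal measure_ball_lt_top.ne,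
      ENNReal.ofReal_rpow_of_nonneg hM hq0.le]
    rfl
  have hS : ∀ s, 0 < s → s ≤ q → ∀ k, ∫⁻ x in aBall n k, ‖b x - β k‖ₑ ^ s ≤
      ENNReal.ofReal M ^ s * volume (aBall n k) := by
    intro s hs hsq k
    have : IsFiniteMeasure (volume.restrict (aBall n k)) :=
      ⟨by rw [Measure.restrict_apply_univ]; exact (aBall_fin n k).lt_top⟩
    have := aux_lower (volume.restrict (aBall n k)) (fun x => b x - β k) (hb.sub_const _) s q hs hsq
      (ENNReal.ofReal M) (by rw [Measure.restrict_apply_univ]; exact hQ k)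
    rwa [Measure.restrict_apply_univ] at this
  have h1 : ∀ k, ∫⁻ x in aBall n k, ‖b x - β k‖ₑ ≤ ENNReal.ofReal M * volume (aBall n k) := by
    intro k
    have := hS 1 one_pos (hp.le.trans (le_max_left _ _)) k
    simpa only [ENNReal.rpow_one] using this
  have h2 := hS p' hp'0 (le_max_right _ _)
  have h3 := hS p hp0 (le_max_left _ _)
  set F : En n → ℝ≥0∞ := fun x => (∑' j : ℕ, (ENNReal.ofReal |f j x|) ^ r) ^ (1 / r) with hFdef
  have hF : Measurable F :=
    (Measurable.tsum fun j => (hf j).abs.ennreal_ofReal.pow_const _).pow_const _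
  rcases hM.eq_or_lt with hM0 | hMpos
  · -- the case `M = 0`: `b` is constant on every ball
    have hae : ∀ k, ∀ᵐ x, x ∈ aBall n k → b x = β k := by
      intro k
      have h := h1 k
      rw [← hM0, ENNReal.ofReal_zero, zero_mul, nonpos_iff_eq_zero,
        lintegral_eq_zero_iff (hb.sub_const _).enorm] at h
      have h' := (ae_restrict_iff' measurableSet_ball).1 h
      filter_upwards [h'] with x hx hxk
      have := hx hxk
      simpa [sub_eq_zero] using this
    have hzero : ∀ᵐ x, ((∑' j : ℕ, (ENNReal.ofReal
        |b x * hardyOp n (f j) x - hardyOp n (fun y => b y * f j y) x|) ^ r) ^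
                (1 / r)) ^ p = 0 := by
      filter_upwards [ae_all_iff.2 hae] with x hx
      have hj : ∀ j, b x * hardyOp n (f j) x - hardyOp n (fun y => b y * f j y) x = 0 := by
        intro j
        by_cases h0 : x = 0
        · have : (0 : ℝ) ^ (-(n : ℝ)) = 0 := Real.zero_rpow (by simpa using hn.ne')
          simp [hardyOp, h0, this]
        obtain ⟨k, hk⟩ := aAnn_exists n x h0
        have hbx : b x = β k := hx k (aAnn_sub n k hk)
        have e : ∫ y in closedBall (0 : En n) ‖x‖, b y * f j y =
            ∫ y in closedBall (0 : En n) ‖x‖, β k * f j y := by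
          apply setIntegral_congr_ae measurableSet_closedBall
          filter_upwards [hae k] with y hy hyc
          rw [hy (closedBall_subset_ball hk.2 hyc)]
        unfold hardyOp
        rw [e, integral_const_mul, hbx]
        ring
      simp [hj, hr0, hp0]
    rw [lintegral_congr_ae hzero]
    simp [hp0]
  by_cases hN : ∫⁻ x, F x ^ p = ∞
  · rw [hN, ENNReal.top_rpow_of_pos (by positivity), ENNReal.mul_top]
    · exact le_top
    · rw [Ne, ENNReal.ofReal_eq_zero, not_le]
      positivity
  -- local integrability
  have hfF : ∀ j y, ‖f j y‖ₑ ≤ F y := by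
    intro j y
    calc ‖f j y‖ₑ = ((ENNReal.ofReal |f j y|) ^ r) ^ (1 / r) := by
          rw [← ENNReal.rpow_mul, mul_one_div_cancel hr0.ne', ENNReal.rpow_one,
            Real.enorm_eq_ofReal_abs]
      _ ≤ _ := ENNReal.rpow_le_rpow
          (ENNReal.le_tsum (f := fun j => (ENNReal.ofReal |f j y|) ^ r) j) (by positivity)
  have hloc : ∀ k (u : En n → ℝ), Measurable u → ∫⁻ y in aBall n k, ‖u y‖ₑ ^ p' ≠ ∞ →
      ∀ j, IntegrableOn (fun y => u y * f j y) (aBall n k) volume := by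
    intro k u hu hut j
    refine ⟨(hu.mul (hf j)).aestronglyMeasurable, ?_⟩
    rw [hasFiniteIntegral_iff_enorm]
    have h := ENNReal.lintegral_mul_le_Lp_mul_Lq (volume.restrict (aBall n k)) hc.symm
      (f := fun y => ‖u y‖ₑ) (g := F) hu.enorm.aemeasurable hF.aemeasurable
    calc ∫⁻ y in aBall n k, ‖u y * f j y‖ₑ ≤ ∫⁻ y in aBall n k, ((fun y => ‖u y‖ₑ) * F) y := by
          apply lintegral_mono
          intro y
          simp only [Pi.mul_apply]
          rw [enorm_mul]
          exact mul_le_mul' le_rfl (hfF j y)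
      _ ≤ _ := h
      _ < ∞ := by
          apply ENNReal.mul_lt_top
          · exact ENNReal.rpow_lt_top_of_nonneg (by positivity) hut
          · exact ENNReal.rpow_lt_top_of_nonneg (by positivity)
              (ne_top_of_le_ne_top hN (setLIntegral_le_lintegral _ _))
  have hfi : ∀ k j, IntegrableOn (f j) (aBall n k) volume := by
    intro k j
    have := hloc k (fun _ => 1) measurable_const (by simpa using aBall_fin n k) j
    simpa using this
  have hbfi : ∀ k j, IntegrableOn (fun y => b y * f j y) (aBall n k) volume := by
    intro k j
    have h := hloc k (fun y => b y - β k) (hb.sub_const _) (ne_top_of_le_ne_top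
      (ENNReal.mul_ne_top (ENNReal.rpow_lt_top_of_nonneg hp'0.le ENNReal.ofReal_ne_top).ne
        (aBall_fin n k)) (h2 k)) j
    refine (h.add ((hfi k j).const_mul (β k))).congr_fun (fun y _ => ?_) measurableSet_ball
    simp only [Pi.add_apply]
    ring
  have hsub : ∀ x : En n, ∃ k, closedBall (0 : En n) ‖x‖ ⊆ aBall n k := by
    intro x
    by_cases h0 : x = 0
    · exact ⟨0, closedBall_subset_ball (by simp [h0])⟩
    · obtain ⟨k, hk⟩ := aAnn_exists n x h0
      exact ⟨k, closedBall_subset_ball hk.2⟩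
  have hpt : ∀ x, _ := fun x => aPoint n r hr b hb f hf x
    (fun j => by obtain ⟨k, hk⟩ := hsub x; exact (hfi k j).mono_set hk)
    (fun j => by obtain ⟨k, hk⟩ := hsub x; exact (hbfi k j).mono_set hk)
  have hcore := aCore n hn p p' hc b hb β (ENNReal.ofReal M) h1 h2 h3 F hF
  calc _ ≤ ((Λ * ENNReal.ofReal M) ^ p * ∫⁻ y, F y ^ p) ^ (1 / p) := by
        refine ENNReal.rpow_le_rpow (le_trans ?_ hcore) (by positivity)
        exact lintegral_mono fun x => ENNReal.rpow_le_rpow (hpt x) hp0.le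
    _ = (Λ * ENNReal.ofReal M) * (∫⁻ y, F y ^ p) ^ (1 / p) := by
        rw [ENNReal.mul_rpow_of_nonneg _ _ (by positivity), ← ENNReal.rpow_mul,
          mul_one_div_cancel hp0.ne', ENNReal.rpow_one]
    _ ≤ _ := by
        refine mul_le_mul' ?_ le_rfl
        rw [ENNReal.ofReal_mul (by positivity)]
        refine mul_le_mul' ?_ le_rfl
        exact (ENNReal.le_ofReal_iff_toReal_le hΛt (by positivity)).2 (by linarith)
end
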